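/- Barycenters for WOP: let μ₁, …, μ_n ∈ M(ℝ^d) with positive masses and λ₁, …, λ_n > 0 with Σλ_i = 1, and define V(μ) := Σ_{i=1}^n λ_i·WOP²(μ, μ_i) on M(ℝ^d). Then any minimizer μ_B of V satisfies m_{μ_B} = Σ_{i=1}^n λ_i·m_{μ_i}, its normalization μ̄_B is a Wasserstein barycenter of the normalized measures with weights λ_i·m_{μ_i}, i.e. μ̄_B minimizes ν ↦ Σ_{i=1}^n λ_i·m_{μ_i}·W₂²(ν, μ̄_i) over P₂(ℝ^d), and the minimizer μ_B does not depend on the reference point x₀. -/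

import Mathlib

open MeasureTheory

noncomputable section

abbrev Euc (d : ℕ) := EuclideanSpace ℝ (Fin d)

variable {d : ℕ}

/-- Total mass of a measure. -/
def mass (μ : Measure (Euc d)) : ℝ := (μ Set.univ).toReal

/-- Second moment centered at `x₀`. -/
def sndMoment (x₀ : Euc d) (μ : Measure (Euc d)) : ℝ := ∫ x, ‖x - x₀‖ ^ 2 ∂μ

/-- `μ ∈ M(ℝ^d)`: finite positive measure with finite second moment. -/
def MemM (μ : Measure (Euc d)) : Prop :=
  IsFiniteMeasure μ ∧ Integrable (fun x => ‖x‖ ^ 2) μ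

/-- `μ ∈ P₂(ℝ^d)`: probability measure with finite second moment. -/
def MemP2 (μ : Measure (Euc d)) : Prop :=
  IsProbabilityMeasure μ ∧ Integrable (fun x => ‖x‖ ^ 2) μ

/-- Squared 2-Wasserstein distance, as an infimum over couplings. -/
def W2sq (μ ν : Measure (Euc d)) : ℝ :=
  sInf { r : ℝ | ∃ π : Measure (Euc d × Euc d),
    π.map Prod.fst = μ ∧ π.map Prod.snd = ν ∧ r = ∫ p, ‖p.1 - p.2‖ ^ 2 ∂π }

/-- 2-Wasserstein distance. -/
def W2 (μ ν : Measure (Euc d)) : ℝ := Real.sqrt (W2sq μ ν)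

/-- The dilation `T_a(x) = a (x - x₀) + x₀`. -/
def dil (x₀ : Euc d) (a : ℝ) (x : Euc d) : Euc d := a • (x - x₀) + x₀

/-- Normalization `μ̄` of `μ`, with the convention `μ̄ = δ_{x₀}` for the null measure. -/
def nm (x₀ : Euc d) (μ : Measure (Euc d)) : Measure (Euc d) :=
  if μ Set.univ = 0 then Measure.dirac x₀ else (μ Set.univ)⁻¹ • μ

/-- Squared WOP metric with reference point `x₀`. -/
def WOP2 (x₀ : Euc d) (μ ν : Measure (Euc d)) : ℝ :=
  (mass μ - mass ν) ^ 2 +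
    W2sq ((nm x₀ μ).map (dil x₀ (mass μ))) ((nm x₀ ν).map (dil x₀ (mass ν)))

/-- The WOP metric with reference point `x₀`. -/
def WOP (x₀ : Euc d) (μ ν : Measure (Euc d)) : ℝ := Real.sqrt (WOP2 x₀ μ ν)

theorem dil_one (x₀ : Euc d) : dil x₀ 1 = id := by
  ext1 x; simp [dil]

theorem dil_comp (x₀ : Euc d) (a b : ℝ) : dil x₀ a ∘ dil x₀ b = dil x₀ (a * b) := by
  ext1 x; simp [dil, smul_smul]

theorem measurable_dil (x₀ : Euc d) (a : ℝ) : Measurable (dil x₀ a) := by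
  unfold dil; fun_prop

theorem map_dil_map_dil (x₀ : Euc d) (a b : ℝ) (μ : Measure (Euc d)) :
    (μ.map (dil x₀ b)).map (dil x₀ a) = μ.map (dil x₀ (a * b)) := by
  rw [Measure.map_map (measurable_dil _ _) (measurable_dil _ _), dil_comp]

theorem integrable_sq_norm_sub {α : Type*} [MeasurableSpace α] {μ : Measure α}
    {f g : α → Euc d} (hf : Measurable f) (hg : Measurable g)
    (hf2 : Integrable (fun x => ‖f x‖ ^ 2) μ) (hg2 : Integrable (fun x => ‖g x‖ ^ 2) μ) :
    Integrable (fun x => ‖f x - g x‖ ^ 2) μ := by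
  have hf' := (memLp_two_iff_integrable_sq_norm hf.aestronglyMeasurable).2 hf2
  have hg' := (memLp_two_iff_integrable_sq_norm hg.aestronglyMeasurable).2 hg2
  exact (memLp_two_iff_integrable_sq_norm (hf.sub hg).aestronglyMeasurable).1 (hf'.sub hg')

theorem MemP2.integrable_sub {μ : Measure (Euc d)} (hμ : MemP2 μ) (x₀ : Euc d) :
    Integrable (fun x => ‖x - x₀‖ ^ 2) μ := by
  have := hμ.1
  exact integrable_sq_norm_sub measurable_id measurable_const hμ.2 (integrable_const _)

theorem MemP2.map_dil {μ : Measure (Euc d)} (hμ : MemP2 μ) (x₀ : Euc d) (a : ℝ) :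
    MemP2 (μ.map (dil x₀ a)) := by
  have := hμ.1
  refine ⟨Measure.isProbabilityMeasure_map (measurable_dil _ _).aemeasurable, ?_⟩
  rw [integrable_map_measure (by fun_prop) (measurable_dil _ _).aemeasurable]
  have h : Integrable (fun x => ‖a • (x - x₀)‖ ^ 2) μ := by
    simpa only [norm_smul, mul_pow] using (hμ.integrable_sub x₀).const_mul (‖a‖ ^ 2)
  simpa [Function.comp_def, dil] using integrable_sq_norm_sub (g := fun _ => -x₀)
    (by fun_prop) measurable_const h (integrable_const _)

theorem sq_norm_dil_sub_dil (x₀ : Euc d) (a b : ℝ) (x y : Euc d) :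
    ‖dil x₀ a x - dil x₀ b y‖ ^ 2 =
      a * (a - b) * ‖x - x₀‖ ^ 2 + b * (b - a) * ‖y - x₀‖ ^ 2 + a * b * ‖x - y‖ ^ 2 := by
  have h1 : dil x₀ a x - dil x₀ b y = a • (x - x₀) - b • (y - x₀) := by simp [dil]
  rw [h1, ← sub_sub_sub_cancel_right x y x₀, norm_sub_sq_real,
    norm_sub_sq_real (x - x₀) (y - x₀), inner_smul_left, inner_smul_right, norm_smul, norm_smul,
    mul_pow, mul_pow, Real.norm_eq_abs, Real.norm_eq_abs, sq_abs, sq_abs]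
  simp only [conj_trivial]
  ring

/-- The transport costs of all couplings of `μ` and `ν`. -/
def couplingCosts (μ ν : Measure (Euc d)) : Set ℝ :=
  { r : ℝ | ∃ π : Measure (Euc d × Euc d),
    π.map Prod.fst = μ ∧ π.map Prod.snd = ν ∧ r = ∫ p, ‖p.1 - p.2‖ ^ 2 ∂π }

theorem couplingCosts_nonempty {μ ν : Measure (Euc d)} (hμ : MemP2 μ) (hν : MemP2 ν) :
    (couplingCosts μ ν).Nonempty := by
  have := hμ.1
  have := hν.1
  exact ⟨_, μ.prod ν, by simp, by simp, rfl⟩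

theorem bddBelow_couplingCosts (μ ν : Measure (Euc d)) : BddBelow (couplingCosts μ ν) := by
  refine ⟨0, ?_⟩
  rintro _ ⟨π, -, -, rfl⟩
  exact integral_nonneg fun _ => by positivity

theorem integral_sq_norm_dil_sub_dil {μ ν : Measure (Euc d)} (hμ : MemP2 μ) (hν : MemP2 ν)
    (x₀ : Euc d) (a b : ℝ) {π : Measure (Euc d × Euc d)}
    (h1 : π.map Prod.fst = μ) (h2 : π.map Prod.snd = ν) :
    ∫ p, ‖dil x₀ a p.1 - dil x₀ b p.2‖ ^ 2 ∂π =
      a * (a - b) * sndMoment x₀ μ + b * (b - a) * sndMoment x₀ ν +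
        a * b * ∫ p, ‖p.1 - p.2‖ ^ 2 ∂π := by
  have i1 : Integrable (fun p : Euc d × Euc d => ‖p.1 - x₀‖ ^ 2) π := by
    have h := hμ.integrable_sub x₀
    rw [← h1] at h
    exact h.comp_measurable measurable_fst
  have i2 : Integrable (fun p : Euc d × Euc d => ‖p.2 - x₀‖ ^ 2) π := by
    have h := hν.integrable_sub x₀
    rw [← h2] at h
    exact h.comp_measurable measurable_snd
  have i3 : Integrable (fun p : Euc d × Euc d => ‖p.1 - p.2‖ ^ 2) π := by
    have h := integrable_sq_norm_sub (by fun_prop) (by fun_prop) i1 i2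
    simpa using h
  have e1 : ∫ p, ‖p.1 - x₀‖ ^ 2 ∂π = sndMoment x₀ μ := by
    rw [sndMoment, ← h1, integral_map (by fun_prop) (by fun_prop)]
  have e2 : ∫ p, ‖p.2 - x₀‖ ^ 2 ∂π = sndMoment x₀ ν := by
    rw [sndMoment, ← h2, integral_map (by fun_prop) (by fun_prop)]
  simp_rw [sq_norm_dil_sub_dil]
  have i12 : Integrable (fun p : Euc d × Euc d =>
      a * (a - b) * ‖p.1 - x₀‖ ^ 2 + b * (b - a) * ‖p.2 - x₀‖ ^ 2) π :=
    (i1.const_mul _).add (i2.const_mul _)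
  rw [integral_add i12 (i3.const_mul _), integral_add (i1.const_mul _) (i2.const_mul _),
    integral_const_mul, integral_const_mul, integral_const_mul, e1, e2]

theorem couplingCosts_map_dil {μ ν : Measure (Euc d)} (hμ : MemP2 μ) (hν : MemP2 ν)
    (x₀ : Euc d) {a b : ℝ} (ha : 0 < a) (hb : 0 < b) :
    couplingCosts (μ.map (dil x₀ a)) (ν.map (dil x₀ b)) =
      (fun r => a * (a - b) * sndMoment x₀ μ + b * (b - a) * sndMoment x₀ ν + a * b * r) ''
        couplingCosts μ ν := by
  have hm : ∀ s t : ℝ, Measurable (Prod.map (dil x₀ s) (dil x₀ t)) := fun s t =>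
    (measurable_dil x₀ s).prodMap (measurable_dil x₀ t)
  have hfst : ∀ (π : Measure (Euc d × Euc d)) (s t : ℝ),
      (π.map (Prod.map (dil x₀ s) (dil x₀ t))).map Prod.fst =
        (π.map Prod.fst).map (dil x₀ s) := fun π s t => by
    rw [Measure.map_map measurable_fst (hm s t),
      Measure.map_map (measurable_dil x₀ s) measurable_fst]
    rfl
  have hsnd : ∀ (π : Measure (Euc d × Euc d)) (s t : ℝ),
      (π.map (Prod.map (dil x₀ s) (dil x₀ t))).map Prod.snd =
        (π.map Prod.snd).map (dil x₀ t) := fun π s t => by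
    rw [Measure.map_map measurable_snd (hm s t),
      Measure.map_map (measurable_dil x₀ t) measurable_snd]
    rfl
  have hcost : ∀ (π : Measure (Euc d × Euc d)) (s t : ℝ),
      ∫ p, ‖p.1 - p.2‖ ^ 2 ∂(π.map (Prod.map (dil x₀ s) (dil x₀ t))) =
        ∫ p, ‖dil x₀ s p.1 - dil x₀ t p.2‖ ^ 2 ∂π := fun π s t => by
    rw [integral_map (hm s t).aemeasurable (by fun_prop)]
    rfl
  ext r
  constructor
  · rintro ⟨π, h1, h2, rfl⟩
    have hπ : (π.map (Prod.map (dil x₀ a⁻¹) (dil x₀ b⁻¹))).map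
        (Prod.map (dil x₀ a) (dil x₀ b)) = π := by
      rw [Measure.map_map (hm _ _) (hm _ _), Prod.map_comp_map, dil_comp, dil_comp,
        mul_inv_cancel₀ ha.ne', mul_inv_cancel₀ hb.ne', dil_one, Prod.map_id,
        Measure.map_id]
    have k1 : (π.map (Prod.map (dil x₀ a⁻¹) (dil x₀ b⁻¹))).map Prod.fst = μ := by
      rw [hfst, h1, map_dil_map_dil, inv_mul_cancel₀ ha.ne', dil_one, Measure.map_id]
    have k2 : (π.map (Prod.map (dil x₀ a⁻¹) (dil x₀ b⁻¹))).map Prod.snd = ν := by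
      rw [hsnd, h2, map_dil_map_dil, inv_mul_cancel₀ hb.ne', dil_one, Measure.map_id]
    refine ⟨_, ⟨_, k1, k2, rfl⟩, ?_⟩
    dsimp only
    rw [← integral_sq_norm_dil_sub_dil hμ hν x₀ a b k1 k2, ← hcost, hπ]
  · rintro ⟨_, ⟨π, h1, h2, rfl⟩, rfl⟩
    refine ⟨π.map (Prod.map (dil x₀ a) (dil x₀ b)), by rw [hfst, h1], by rw [hsnd, h2], ?_⟩
    rw [hcost, integral_sq_norm_dil_sub_dil hμ hν x₀ a b h1 h2]

theorem W2sq_map_dil {μ ν : Measure (Euc d)} (hμ : MemP2 μ) (hν : MemP2 ν)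
    (x₀ : Euc d) {a b : ℝ} (ha : 0 < a) (hb : 0 < b) :
    W2sq (μ.map (dil x₀ a)) (ν.map (dil x₀ b)) =
      a * (a - b) * sndMoment x₀ μ + b * (b - a) * sndMoment x₀ ν + a * b * W2sq μ ν := by
  change sInf (couplingCosts _ _) = _ + a * b * sInf (couplingCosts μ ν)
  rw [couplingCosts_map_dil hμ hν x₀ ha hb]
  refine (Monotone.map_csInf_of_continuousAt
    (f := fun r => a * (a - b) * sndMoment x₀ μ + b * (b - a) * sndMoment x₀ ν + a * b * r)
    (by fun_prop) (fun r s hrs => ?_) (couplingCosts_nonempty hμ hν)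
    (bddBelow_couplingCosts μ ν)).symm
  have := mul_le_mul_of_nonneg_left hrs (mul_pos ha hb).le
  dsimp only
  linarith

theorem nm_of_mass_pos (x₀ : Euc d) {μ : Measure (Euc d)} (h : 0 < mass μ) :
    nm x₀ μ = (μ Set.univ)⁻¹ • μ :=
  if_neg fun h0 => by simp [mass, h0] at h

theorem nm_eq_nm (x₀ y₀ : Euc d) {μ : Measure (Euc d)} (h : 0 < mass μ) :
    nm x₀ μ = nm y₀ μ := by
  rw [nm_of_mass_pos x₀ h, nm_of_mass_pos y₀ h]

theorem MemM.memP2_nm {μ : Measure (Euc d)} (hμ : MemM μ) (x₀ : Euc d) : MemP2 (nm x₀ μ) := by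
  have := hμ.1
  unfold nm
  split_ifs with h
  · exact ⟨inferInstance, integrable_dirac (by simp)⟩
  · refine ⟨⟨?_⟩, hμ.2.smul_measure (ENNReal.inv_ne_top.2 h)⟩
    simp [ENNReal.inv_mul_cancel h (measure_ne_top μ _)]

theorem MemP2.memM_smul {P : Measure (Euc d)} (hP : MemP2 P) (c : ℝ) :
    MemM (ENNReal.ofReal c • P) := by
  have := hP.1
  exact ⟨Measure.smul_finite P ENNReal.ofReal_ne_top, hP.2.smul_measure ENNReal.ofReal_ne_top⟩

theorem MemP2.mass_smul {P : Measure (Euc d)} (hP : MemP2 P) {c : ℝ} (hc : 0 < c) :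
    mass (ENNReal.ofReal c • P) = c := by
  have := hP.1
  simp [mass, hc.le]

theorem MemP2.nm_smul {P : Measure (Euc d)} (hP : MemP2 P) (x₀ : Euc d) {c : ℝ} (hc : 0 < c) :
    nm x₀ (ENNReal.ofReal c • P) = P := by
  have := hP.1
  rw [nm_of_mass_pos x₀ ((hP.mass_smul hc).symm ▸ hc), smul_smul]
  simp [ENNReal.inv_mul_cancel, hc]

theorem sum_mul_sq_sub {n : ℕ} {lam : Fin n → ℝ} (hsum : ∑ i, lam i = 1)
    (m : Fin n → ℝ) (b : ℝ) :
    ∑ i, lam i * (b - m i) ^ 2 = ∑ i, lam i * ((∑ j, lam j * m j) - m i) ^ 2 +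
      (b - ∑ j, lam j * m j) ^ 2 := by
  set c := ∑ j, lam j * m j with hc
  have h : ∀ i, lam i * (b - m i) ^ 2 =
      lam i * (c - m i) ^ 2 + (lam i * (b ^ 2 - c ^ 2) - 2 * (b - c) * (lam i * m i)) := fun i => by
    ring
  rw [Finset.sum_congr rfl fun i _ => h i, Finset.sum_add_distrib, Finset.sum_sub_distrib,
    ← Finset.sum_mul, ← Finset.mul_sum, hsum, ← hc]
  ring

/-- Replacing the mass by the weighted mean while keeping the dilated normalization fixed
lowers the objective by the squared distance of the masses. -/
theorem exists_mean_mass {n : ℕ} {lam : Fin n → ℝ} (hsum : ∑ i, lam i = 1)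
    (μs : Fin n → Measure (Euc d)) (hc : 0 < ∑ i, lam i * mass (μs i)) (y₀ : Euc d)
    {ν : Measure (Euc d)} (hν : MemM ν) :
    ∃ ν', MemM ν' ∧ mass ν' = ∑ i, lam i * mass (μs i) ∧
      ∑ i, lam i * WOP2 y₀ ν (μs i) = ∑ i, lam i * WOP2 y₀ ν' (μs i) +
        (mass ν - ∑ i, lam i * mass (μs i)) ^ 2 := by
  have hP := (hν.memP2_nm y₀).map_dil y₀ ((∑ i, lam i * mass (μs i))⁻¹ * mass ν)
  refine ⟨_, hP.memM_smul _, hP.mass_smul hc, ?_⟩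
  simp only [WOP2, hP.mass_smul hc, hP.nm_smul y₀ hc, map_dil_map_dil,
    mul_inv_cancel_left₀ hc.ne', mul_add, Finset.sum_add_distrib]
  rw [sum_mul_sq_sub hsum (fun i => mass (μs i)) (mass ν)]
  ring

theorem sum_WOP2_of_mean_mass {n : ℕ} {lam : Fin n → ℝ} {μs : Fin n → Measure (Euc d)}
    (hμs : ∀ i, MemM (μs i)) (hpos : ∀ i, 0 < mass (μs i))
    (hc : 0 < ∑ i, lam i * mass (μs i)) (hsum : ∑ i, lam i = 1) (x₀ y₀ : Euc d)
    {ν : Measure (Euc d)} (hν : MemM ν) (hm : mass ν = ∑ i, lam i * mass (μs i)) :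
    ∑ i, lam i * WOP2 y₀ ν (μs i) =
      ∑ i, lam i * ((mass ν - mass (μs i)) ^ 2 +
        mass (μs i) * (mass (μs i) - mass ν) * sndMoment y₀ (nm y₀ (μs i))) +
      mass ν * ∑ i, lam i * mass (μs i) * W2sq (nm x₀ ν) (nm x₀ (μs i)) := by
  have hν0 : 0 < mass ν := hm ▸ hc
  have h : ∀ i, lam i * WOP2 y₀ ν (μs i) =
      lam i * ((mass ν - mass (μs i)) ^ 2 +
        mass (μs i) * (mass (μs i) - mass ν) * sndMoment y₀ (nm y₀ (μs i))) +
      mass ν * (lam i * mass (μs i) * W2sq (nm x₀ ν) (nm x₀ (μs i))) +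
      (mass ν * sndMoment y₀ (nm y₀ ν)) * (lam i * mass ν - lam i * mass (μs i)) := fun i => by
    rw [WOP2, W2sq_map_dil (hν.memP2_nm y₀) ((hμs i).memP2_nm y₀) y₀ hν0 (hpos i),
      nm_eq_nm x₀ y₀ hν0, nm_eq_nm x₀ y₀ (hpos i)]
    ring
  rw [Finset.sum_congr rfl fun i _ => h i, Finset.sum_add_distrib, Finset.sum_add_distrib,
    ← Finset.mul_sum, ← Finset.mul_sum, Finset.sum_sub_distrib, ← Finset.sum_mul, hsum, ← hm]
  ring

/-- barycenters for `WOP`.  A minimizer `μ_B` of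
`V(μ) = Σ λᵢ WOP²(μ, μᵢ)` has mass `Σ λᵢ m_{μᵢ}`, its normalization is a
Wasserstein barycenter of the normalized measures with weights `λᵢ m_{μᵢ}`, and
`μ_B` minimizes the corresponding functional for every reference point `y₀`. -/
theorem WOP_barycenter (d : ℕ) (x₀ : Euc d) (n : ℕ) (μs : Fin n → Measure (Euc d))
    (hμs : ∀ i, MemM (μs i)) (hpos : ∀ i, 0 < mass (μs i))
    (lam : Fin n → ℝ) (hlam : ∀ i, 0 < lam i) (hsum : ∑ i, lam i = 1)
    (μB : Measure (Euc d)) (hB : MemM μB)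
    (hmin : ∀ ν : Measure (Euc d), MemM ν →
      ∑ i, lam i * WOP2 x₀ μB (μs i) ≤ ∑ i, lam i * WOP2 x₀ ν (μs i)) :
    mass μB = (∑ i, lam i * mass (μs i)) ∧
    (∀ ν : Measure (Euc d), MemP2 ν →
      ∑ i, lam i * mass (μs i) * W2sq (nm x₀ μB) (nm x₀ (μs i)) ≤
        ∑ i, lam i * mass (μs i) * W2sq ν (nm x₀ (μs i))) ∧
    (∀ y₀ : Euc d, ∀ ν : Measure (Euc d), MemM ν →
      ∑ i, lam i * WOP2 y₀ μB (μs i) ≤ ∑ i, lam i * WOP2 y₀ ν (μs i)) := by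
  have hc : 0 < ∑ i, lam i * mass (μs i) := by
    refine Finset.sum_pos (fun i _ => mul_pos (hlam i) (hpos i)) ?_
    by_contra hne
    simp [Finset.not_nonempty_iff_eq_empty.1 hne] at hsum
  have hmass : mass μB = ∑ i, lam i * mass (μs i) := by
    obtain ⟨ν', hν', -, h⟩ := exists_mean_mass hsum μs hc x₀ hB
    have := hmin ν' hν'
    have h0 : (mass μB - ∑ i, lam i * mass (μs i)) ^ 2 = 0 :=
      le_antisymm (by linarith) (sq_nonneg _)
    exact sub_eq_zero.1 (pow_eq_zero_iff two_ne_zero |>.1 h0)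
  have hbary : ∀ ν : Measure (Euc d), MemP2 ν →
      ∑ i, lam i * mass (μs i) * W2sq (nm x₀ μB) (nm x₀ (μs i)) ≤
        ∑ i, lam i * mass (μs i) * W2sq ν (nm x₀ (μs i)) := fun ν hν => by
    have hm := hν.mass_smul hc
    have h := hmin _ (hν.memM_smul (∑ i, lam i * mass (μs i)))
    rw [sum_WOP2_of_mean_mass hμs hpos hc hsum x₀ x₀ hB hmass,
      sum_WOP2_of_mean_mass hμs hpos hc hsum x₀ x₀ (hν.memM_smul _) hm, hm, hmass,
      hν.nm_smul x₀ hc] at h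
    exact le_of_mul_le_mul_left (le_of_add_le_add_left h) hc
  refine ⟨hmass, hbary, fun y₀ ν hν => ?_⟩
  obtain ⟨ν', hν', hm, h⟩ := exists_mean_mass hsum μs hc y₀ hν
  rw [h, sum_WOP2_of_mean_mass hμs hpos hc hsum x₀ y₀ hB hmass,
    sum_WOP2_of_mean_mass hμs hpos hc hsum x₀ y₀ hν' hm, hm, hmass]
  have := mul_le_mul_of_nonneg_left (hbary _ (hν'.memP2_nm x₀)) hc.le
  linarith [sq_nonneg (mass ν - ∑ i, lam i * mass (μs i))]

end
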